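/- Let s ≥ 0 be an integer with 2s+1 ≤ n. For r ∈ {1,…,2n} define c_r := (1/4)·Σ_{j=1}^{n} (x_j·[x_r, x_{j+n}] − x_{j+n}·[x_r, x_j]) + x_r·ω ∈ A_{2n}. Then the element Z := Σ_{i=1}^{n} ([x_i, c_{i+n}·ω^s] − [x_{i+n}, c_i·ω^s]) lies in L_3(A_{2n}) but does not lie in L_4(A_{2n}). -/

import Mathlib

noncomputable section

/-- Lower central series: `lcs A 1 = A`, `lcs A (k+1) = [A, lcs A k]` (ℂ-linear span). -/
def lcs (A : Type) [Ring A] [Algebra ℂ A] : ℕ → Submodule ℂ A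
  | 0 => ⊤
  | 1 => ⊤
  | (k+2) => Submodule.span ℂ {x | ∃ a : A, ∃ b ∈ lcs A (k+1), x = a * b - b * a}

/-- The free algebra on `2n` generators. -/
abbrev FA (n : ℕ) : Type := FreeAlgebra ℂ (Fin (2*n))

/-- The generator `x_j` (1-based indexing, junk value `0` out of range). -/
def X (n : ℕ) (j : ℕ) : FA n :=
  if h : 1 ≤ j ∧ j ≤ 2*n then FreeAlgebra.ι ℂ (⟨j-1, by omega⟩ : Fin (2*n)) else 0

/-- `ω = (1/2) ∑ᵢ [xᵢ, xᵢ₊ₙ]`. -/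
def omg (n : ℕ) : FA n :=
  (1/2 : ℂ) • ∑ i ∈ Finset.Icc 1 n, (X n i * X n (i+n) - X n (i+n) * X n i)


/-- The commutator `[a,b] = ab − ba`. -/
def com (n : ℕ) (a b : FA n) : FA n := a * b - b * a

/-- `c_r := (1/4)·∑_{j=1}^{n} (x_j·[x_r, x_{j+n}] − x_{j+n}·[x_r, x_j]) + x_r·ω`. -/
def cvec (n : ℕ) (r : ℕ) : FA n :=
  ((1/4 : ℂ) • ∑ j ∈ Finset.Icc 1 n,
      (X n j * com n (X n r) (X n (j+n)) - X n (j+n) * com n (X n r) (X n j)))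
    + X n r * omg n

section LowerCentralSeries

variable {A : Type} [Ring A] [Algebra ℂ A]

theorem commutator_mem_lcs (k : ℕ) (a : A) {b : A} (hb : b ∈ lcs A (k + 1)) :
    a * b - b * a ∈ lcs A (k + 2) :=
  Submodule.subset_span ⟨a, b, hb, rfl⟩

theorem commutator_mem_lcs_two (a b : A) : a * b - b * a ∈ lcs A 2 :=
  commutator_mem_lcs 0 a Submodule.mem_top

theorem lcs_succ_induction {k : ℕ} {P : A → Prop}
    (hcomm : ∀ a, ∀ b ∈ lcs A (k + 1), P (a * b - b * a))
    (hadd : ∀ a b, P a → P b → P (a + b)) (hsmul : ∀ (c : ℂ) a, P a → P (c • a))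
    (hzero : P 0) {x : A} (hx : x ∈ lcs A (k + 2)) : P x := by
  refine Submodule.span_induction ?_ hzero (fun a b _ _ => hadd a b) (fun c a _ => hsmul c a) hx
  rintro _ ⟨a, b, hb, rfl⟩
  exact hcomm a b hb

theorem lcs_three_le_two : lcs A 3 ≤ lcs A 2 := by
  refine Submodule.span_le.2 ?_
  rintro _ ⟨a, b, -, rfl⟩
  exact commutator_mem_lcs_two a b

/-- Commuting with a product of two commutators lands in the third term of the series. -/
theorem commutator_mul_commutators_mem (x c b d e : A) :
    x * ((c * b - b * c) * (d * e - e * d)) - ((c * b - b * c) * (d * e - e * d)) * x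
      ∈ lcs A 3 := by
  let f : A → A → A → A → A → A ⧸ lcs A 3 := fun x c b d e => (lcs A 3).mkQ
    (x * ((c * b - b * c) * (d * e - e * d)) - ((c * b - b * c) * (d * e - e * d)) * x)
  let g : A → A → A → A → A → A ⧸ lcs A 3 := fun x b c d e => (lcs A 3).mkQ
    (x * (b * (c * (d * e - e * d) - (d * e - e * d) * c))
      - (b * (c * (d * e - e * d) - (d * e - e * d) * c)) * x)
  have hzero : ∀ y ∈ lcs A 3, (lcs A 3).mkQ y = 0 := fun y hy => by simpa using hy
  have hgf : ∀ x b c d e, g x b c d e = - f x c b d e := by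
    intro x b c d e
    rw [← add_eq_zero_iff_eq_neg]
    simp only [f, g, ← map_add]
    refine hzero _ ?_
    convert commutator_mem_lcs 1 x (commutator_mem_lcs_two c (b * (d * e - e * d))) using 1
    noncomm_ring
  have hg : ∀ x b c d e, g x b c d e = - g b x c d e := by
    intro x b c d e
    rw [← add_eq_zero_iff_eq_neg]
    simp only [g, ← map_add]
    refine hzero _ ?_
    have hm : c * (d * e - e * d) - (d * e - e * d) * c ∈ lcs A 3 :=
      commutator_mem_lcs 1 c (commutator_mem_lcs_two d e)
    have h1 := commutator_mem_lcs 1 (x * b) (lcs_three_le_two hm)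
    have h2 := commutator_mem_lcs 1 b
      (commutator_mem_lcs_two x (c * (d * e - e * d) - (d * e - e * d) * c))
    convert add_mem h1 h2 using 1
    noncomm_ring
  have s1 : ∀ x c b d e, f x c b d e = - f x b c d e := by
    intro x c b d e
    simp only [f, ← map_neg]
    congr 1
    noncomm_ring
  have s3 : ∀ x c b d e, f x c b d e = f x d e c b := by
    intro x c b d e
    rw [← sub_eq_zero]
    simp only [f, ← map_sub]
    refine hzero _ ?_
    convert commutator_mem_lcs 1 x
      (commutator_mem_lcs_two (c * b - b * c) (d * e - e * d)) using 1
    noncomm_ring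
  have s4 : ∀ x c b d e, f x c b d e = - f b c x d e := by
    intro x c b d e
    have := hg x b c d e
    rw [hgf, hgf] at this
    exact neg_injective this
  have hJ : ∀ x b c d e, g x b c d e + g x b d e c + g x b e c d = 0 := by
    intro x b c d e
    simp only [g, ← map_add]
    refine (congrArg _ ?_).trans (map_zero _)
    noncomm_ring
  have t1 : ∀ x c b d e, f x c b d e = - f c x b d e := by
    intro x c b d e
    rw [s1, s4, s1, neg_neg]
  have t2 : ∀ x c b d e, f x c b d e = - f d c b x e := by
    intro x c b d e
    rw [s3, t1, s3]
  have t3 : ∀ x c b d e, f x c b d e = - f x d b c e := by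
    intro x c b d e
    rw [t1, t2, t1]
    simp
  have s2 : ∀ x c b d e, f x c b d e = - f x c b e d := by
    intro x c b d e
    rw [s3, s1, s3]
  have hcyc : ∀ x c b d e, f x d b e c = f x c b d e := by
    intro x c b d e
    rw [s2, t3, neg_neg]
  have h3 : (3 : ℂ) • f x c b d e = 0 := by
    have := hJ x b c d e
    rw [hgf, hgf, hgf, hcyc x c b d e, hcyc x d b e c, hcyc x c b d e] at this
    rw [show (3 : ℂ) = 1 + 1 + 1 by norm_num, add_smul, add_smul, one_smul]
    rw [← neg_eq_zero, ← this]
    abel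
  have h0 : f x c b d e = 0 := by
    rcases smul_eq_zero.1 h3 with h | h
    · norm_num at h
    · exact h
  exact (Submodule.Quotient.mk_eq_zero _).1 h0

/-- The left ideal generated by the third term of the lower central series. -/
def lcsIdeal (A : Type) [Ring A] [Algebra ℂ A] : Submodule ℂ A :=
  Submodule.span ℂ {x | ∃ a : A, ∃ m ∈ lcs A 3, x = a * m}

theorem mul_mem_lcsIdeal (a : A) {x : A} (hx : x ∈ lcsIdeal A) : a * x ∈ lcsIdeal A := by
  induction hx using Submodule.span_induction with
  | mem x h =>
    obtain ⟨b, m, hm, rfl⟩ := h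
    exact Submodule.subset_span ⟨a * b, m, hm, (mul_assoc _ _ _).symm⟩
  | zero => simp
  | add x y _ _ hx hy => rw [mul_add]; exact add_mem hx hy
  | smul c x _ hx => rw [mul_smul_comm]; exact Submodule.smul_mem _ _ hx

theorem lcsIdeal_mul_mem {x : A} (hx : x ∈ lcsIdeal A) (a : A) : x * a ∈ lcsIdeal A := by
  induction hx using Submodule.span_induction with
  | mem x h =>
    obtain ⟨b, m, hm, rfl⟩ := h
    have h1 : b * a * m ∈ lcsIdeal A := Submodule.subset_span ⟨b * a, m, hm, rfl⟩
    have h2 : b * (a * m - m * a) ∈ lcsIdeal A := Submodule.subset_span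
      ⟨b, _, commutator_mem_lcs 1 a (lcs_three_le_two hm), rfl⟩
    convert sub_mem h1 h2 using 1
    noncomm_ring
  | zero => simp
  | add x y _ _ hx hy => rw [add_mul]; exact add_mem hx hy
  | smul c x _ hx => rw [smul_mul_assoc]; exact Submodule.smul_mem _ _ hx

theorem commutator_pow_mem_lcsIdeal (a : A) {w : A} (hw : w ∈ lcs A 2) (s : ℕ) :
    a * w ^ s - w ^ s * a ∈ lcsIdeal A := by
  induction s with
  | zero => simp
  | succ s ih =>
    have h1 : w ^ s * (a * w - w * a) ∈ lcsIdeal A :=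
      Submodule.subset_span ⟨_, _, commutator_mem_lcs 1 a hw, rfl⟩
    convert add_mem h1 (lcsIdeal_mul_mem ih w) using 1
    rw [pow_succ]
    noncomm_ring

theorem commutator_lcsIdeal_mem (x : A) {y : A} (hy : y ∈ lcsIdeal A) :
    x * y - y * x ∈ lcs A 3 := by
  induction hy using Submodule.span_induction with
  | mem y h =>
    obtain ⟨b, m, hm, rfl⟩ := h
    refine lcs_succ_induction (k := 1) (P := fun m => x * (b * m) - b * m * x ∈ lcs A 3)
      ?_ ?_ ?_ ?_ hm
    · intro c l hl
      refine lcs_succ_induction (k := 0)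
        (P := fun l => x * (b * (c * l - l * c)) - b * (c * l - l * c) * x ∈ lcs A 3)
        ?_ ?_ ?_ ?_ hl
      · intro d e _
        have h1 := commutator_mem_lcs 1 x (commutator_mem_lcs_two c (b * (d * e - e * d)))
        convert sub_mem h1 (commutator_mul_commutators_mem x c b d e) using 1
        noncomm_ring
      · intro u v hu hv
        convert add_mem hu hv using 1
        noncomm_ring
      · intro r u hu
        convert Submodule.smul_mem _ r hu using 1
        simp only [mul_smul_comm, smul_mul_assoc, smul_sub, mul_sub, sub_mul]
      · simp
    · intro u v hu hv
      convert add_mem hu hv using 1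
      noncomm_ring
    · intro r u hu
      convert Submodule.smul_mem _ r hu using 1
      simp only [mul_smul_comm, smul_mul_assoc, smul_sub]
    · simp
  | zero => simp
  | add u v _ _ hu hv =>
    convert add_mem hu hv using 1
    noncomm_ring
  | smul r u _ hu =>
    convert Submodule.smul_mem _ r hu using 1
    simp only [mul_smul_comm, smul_mul_assoc, smul_sub]

/-- `[x, l * w ^ s]` lies in the third term of the series whenever `l` and `w` lie in the
second. -/
theorem commutator_mul_pow_mem (x : A) {l w : A} (hl : l ∈ lcs A 2) (hw : w ∈ lcs A 2) (s : ℕ) :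
    x * (l * w ^ s) - l * w ^ s * x ∈ lcs A 3 := by
  refine lcs_succ_induction (k := 0)
    (P := fun l => x * (l * w ^ s) - l * w ^ s * x ∈ lcs A 3) ?_ ?_ ?_ ?_ hl
  · intro a b _
    have h1 := commutator_mem_lcs 1 x (commutator_mem_lcs_two a (b * w ^ s))
    have h2 := commutator_lcsIdeal_mem x
      (mul_mem_lcsIdeal b (commutator_pow_mem_lcsIdeal a hw s))
    convert sub_mem h1 h2 using 1
    noncomm_ring
  · intro u v hu hv
    convert add_mem hu hv using 1
    noncomm_ring
  · intro r u hu
    convert Submodule.smul_mem _ r hu using 1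
    simp only [mul_smul_comm, smul_mul_assoc, smul_sub]
  · simp

end LowerCentralSeries

theorem omg_mem_lcs_two (n : ℕ) : omg n ∈ lcs (FA n) 2 :=
  Submodule.smul_mem _ _ (Submodule.sum_mem _ fun _ _ => commutator_mem_lcs_two _ _)

theorem cvec_mem_lcs_two (n r : ℕ) : cvec n r ∈ lcs (FA n) 2 := by
  have key : ∀ a b c : FA n,
      a * com n c b - b * com n c a + 2 * (c * com n a b) ∈ lcs (FA n) 2 := by
    intro a b c
    have h1 := commutator_mem_lcs_two (a * c) b
    have h2 := commutator_mem_lcs_two (b * c) a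
    have h3 := commutator_mem_lcs_two c (a * b - b * a)
    convert add_mem (sub_mem h1 h2) (add_mem h3 h3) using 1
    unfold com
    noncomm_ring
  have hhalf : ∀ y : FA n, (1 / 2 : ℂ) • y = (1 / 4 : ℂ) • (2 * y) := by
    intro y
    rw [two_mul y, smul_add, ← add_smul]
    norm_num
  have h : cvec n r = (1 / 4 : ℂ) • ∑ j ∈ Finset.Icc 1 n,
      (X n j * com n (X n r) (X n (j + n)) - X n (j + n) * com n (X n r) (X n j)
        + 2 * (X n r * com n (X n j) (X n (j + n)))) := by
    rw [Finset.sum_add_distrib, smul_add, ← Finset.mul_sum, ← Finset.mul_sum, cvec, omg]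
    congr 1
    rw [mul_smul_comm, hhalf]
    rfl
  rw [h]
  exact Submodule.smul_mem _ _ (Submodule.sum_mem _ fun _ _ => key _ _ _)

section Superalgebra

/-- The exterior algebra on countably many odd generators. -/
abbrev GrassmannAlg : Type := ExteriorAlgebra ℂ (ℕ →₀ ℂ)

/-- The odd generators of the exterior algebra. -/
def oddGen (j : ℕ) : GrassmannAlg := ExteriorAlgebra.ι ℂ (Finsupp.single j 1)

/-- The parity automorphism. -/
def parity : GrassmannAlg →ₐ[ℂ] GrassmannAlg := ExteriorAlgebra.map (-LinearMap.id)

/-- The perturbation of the parity automorphism that sends the first generator to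
`-(oddGen 1 + oddGen 0)`. -/
def twist : GrassmannAlg →ₐ[ℂ] GrassmannAlg :=
  ExteriorAlgebra.map (-LinearMap.id - (Finsupp.lapply 1).smulRight (Finsupp.single 0 1))

theorem oddGen_mul_self (j : ℕ) : oddGen j * oddGen j = 0 :=
  ExteriorAlgebra.ι_sq_zero _

theorem parity_ι (v : ℕ →₀ ℂ) : parity (ExteriorAlgebra.ι ℂ v) = - ExteriorAlgebra.ι ℂ v := by
  simp [parity]

@[simp]
theorem parity_oddGen (j : ℕ) : parity (oddGen j) = - oddGen j :=
  parity_ι _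

theorem twist_ι (v : ℕ →₀ ℂ) :
    twist (ExteriorAlgebra.ι ℂ v) = - ExteriorAlgebra.ι ℂ v - v 1 • oddGen 0 := by
  simp [twist, oddGen, -Finsupp.smul_single]

theorem twist_oddGen (j : ℕ) :
    twist (oddGen j) = - oddGen j - if j = 1 then oddGen 0 else 0 := by
  rw [oddGen, twist_ι, Finsupp.single_apply]
  split_ifs <;> simp

@[simp]
theorem parity_parity (x : GrassmannAlg) : parity (parity x) = x := by
  have : parity.comp parity = AlgHom.id ℂ GrassmannAlg := by
    ext v
    simp [parity]
  exact DFunLike.congr_fun this x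

theorem ι_mul_eq (v : ℕ →₀ ℂ) (b : GrassmannAlg) :
    ExteriorAlgebra.ι ℂ v * b = parity b * ExteriorAlgebra.ι ℂ v := by
  induction b using ExteriorAlgebra.induction with
  | algebraMap r => simp [Algebra.commutes]
  | ι x =>
    rw [parity_ι, neg_mul]
    exact eq_neg_of_add_eq_zero_left (ExteriorAlgebra.ι_add_mul_swap v x)
  | mul a b ha hb => rw [← mul_assoc, ha, mul_assoc, hb, map_mul, mul_assoc]
  | add a b ha hb => rw [mul_add, ha, hb, map_add, add_mul]

theorem mul_eq_of_even (a : GrassmannAlg) {b : GrassmannAlg} (hb : parity b = b) :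
    a * b = b * a := by
  induction a using ExteriorAlgebra.induction with
  | algebraMap r => exact Algebra.commutes _ _
  | ι x => rw [ι_mul_eq, hb]
  | mul x y hx hy => rw [mul_assoc, hy, ← mul_assoc, hx, mul_assoc]
  | add x y hx hy => rw [add_mul, hx, hy, mul_add]

theorem mul_eq_of_odd (a : GrassmannAlg) {b : GrassmannAlg} (hb : parity b = -b) :
    a * b = b * parity a := by
  induction a using ExteriorAlgebra.induction with
  | algebraMap r => simp [Algebra.commutes]
  | ι x => rw [ι_mul_eq, hb, parity_ι, neg_mul, mul_neg]
  | mul x y hx hy => rw [mul_assoc, hy, ← mul_assoc, hx, mul_assoc, map_mul]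
  | add x y hx hy => rw [add_mul, hx, hy, map_add, mul_add]

theorem oddGen_mul_oddGen (i j : ℕ) : oddGen i * oddGen j = - (oddGen j * oddGen i) := by
  rw [mul_eq_of_odd _ (parity_oddGen j), parity_oddGen, mul_neg]

theorem parity_add_parity (x : GrassmannAlg) : parity (x + parity x) = x + parity x := by
  rw [map_add, parity_parity, add_comm]

theorem parity_sub_parity (x : GrassmannAlg) : parity (x - parity x) = - (x - parity x) := by
  rw [map_sub, parity_parity, neg_sub]

/-- The ideal generated by the zeroth odd generator. -/
def genIdeal : Submodule ℂ GrassmannAlg := LinearMap.range (LinearMap.mulLeft ℂ (oddGen 0))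

theorem mem_genIdeal {x : GrassmannAlg} : x ∈ genIdeal ↔ ∃ y, oddGen 0 * y = x := Iff.rfl

theorem genIdeal_mul_mem {x : GrassmannAlg} (hx : x ∈ genIdeal) (a : GrassmannAlg) :
    x * a ∈ genIdeal := by
  obtain ⟨y, rfl⟩ := mem_genIdeal.1 hx
  exact mem_genIdeal.2 ⟨y * a, (mul_assoc _ _ _).symm⟩

theorem mul_mem_genIdeal (a : GrassmannAlg) {x : GrassmannAlg} (hx : x ∈ genIdeal) :
    a * x ∈ genIdeal := by
  obtain ⟨y, rfl⟩ := mem_genIdeal.1 hx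
  refine mem_genIdeal.2 ⟨parity a * y, ?_⟩
  rw [← mul_assoc, ← mul_assoc, mul_eq_of_odd a (parity_oddGen 0)]

theorem genIdeal_mul_genIdeal {x y : GrassmannAlg} (hx : x ∈ genIdeal) (hy : y ∈ genIdeal) :
    x * y = 0 := by
  obtain ⟨y, rfl⟩ := mem_genIdeal.1 hy
  obtain ⟨x, rfl⟩ := mem_genIdeal.1 hx
  rw [mul_assoc, ← mul_assoc x, mul_eq_of_odd x (parity_oddGen 0), mul_assoc, ← mul_assoc,
    oddGen_mul_self, zero_mul]

theorem parity_mem_genIdeal {x : GrassmannAlg} (hx : x ∈ genIdeal) : parity x ∈ genIdeal := by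
  obtain ⟨y, rfl⟩ := mem_genIdeal.1 hx
  rw [map_mul, parity_oddGen, neg_mul, ← mul_neg]
  exact mem_genIdeal.2 ⟨_, rfl⟩

theorem twist_sub_parity_mem (a : GrassmannAlg) : twist a - parity a ∈ genIdeal := by
  induction a using ExteriorAlgebra.induction with
  | algebraMap r => simp
  | ι v =>
    refine mem_genIdeal.2 ⟨algebraMap ℂ GrassmannAlg (-v 1), ?_⟩
    rw [twist_ι, parity_ι, ← Algebra.commutes, ← Algebra.smul_def, neg_smul]
    abel
  | mul a b ha hb =>
    convert add_mem (mul_mem_genIdeal (twist a) hb) (genIdeal_mul_mem ha (parity b)) using 1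
    rw [map_mul, map_mul]
    noncomm_ring
  | add a b ha hb =>
    convert add_mem ha hb using 1
    rw [map_add, map_add]
    abel

/-- Twice the even part. -/
def evenPart : GrassmannAlg →ₗ[ℂ] GrassmannAlg := LinearMap.id + parity.toLinearMap

theorem evenPart_apply (x : GrassmannAlg) : evenPart x = x + parity x := rfl

theorem parity_evenPart (x : GrassmannAlg) : parity (evenPart x) = evenPart x :=
  parity_add_parity x

theorem evenPart_mem_genIdeal {x : GrassmannAlg} (hx : x ∈ genIdeal) : evenPart x ∈ genIdeal :=
  add_mem hx (parity_mem_genIdeal hx)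

theorem two_smul_superCommutator (a x : GrassmannAlg) :
    (2 : ℂ) • (a * x - x * parity a) = evenPart x * (a - parity a) := by
  have h1 := mul_eq_of_even a (parity_add_parity x)
  have h2 := mul_eq_of_odd a (parity_sub_parity x)
  rw [evenPart_apply]
  have h : (2 : ℂ) • (a * x) = a * (x + parity x) + a * (x - parity x) := by
    rw [two_smul]
    noncomm_ring
  rw [smul_sub, h, h1, h2, two_smul]
  noncomm_ring

theorem evenPart_superCommutator (a x : GrassmannAlg) : evenPart (a * x - x * parity a) = 0 := by
  have h : (2 : ℂ) • evenPart (a * x - x * parity a) = 0 := by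
    rw [← map_smul, two_smul_superCommutator, evenPart_apply, map_mul, parity_sub_parity,
      parity_evenPart, mul_neg, add_neg_cancel]
  exact (smul_eq_zero.1 h).resolve_left two_ne_zero

theorem superCommutator_mem_genIdeal (a : GrassmannAlg) {x : GrassmannAlg}
    (hx : evenPart x ∈ genIdeal) : a * x - x * parity a ∈ genIdeal := by
  have h := genIdeal_mul_mem hx (a - parity a)
  rw [← two_smul_superCommutator] at h
  exact (Submodule.smul_mem_iff _ two_ne_zero).1 h

theorem commutator_even (a b : GrassmannAlg) : parity (a * b - b * a) = a * b - b * a := by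
  have h : ∀ x y : GrassmannAlg,
      (2 : ℂ) • (x * y - y * x) = (x - parity x) * y - y * (x - parity x) := by
    intro x y
    have h1 := mul_eq_of_even y (parity_add_parity x)
    have h2 : x = (2⁻¹ : ℂ) • (x + parity x) + (2⁻¹ : ℂ) • (x - parity x) := by
      rw [← smul_add, add_add_sub_cancel, ← two_smul ℂ x, smul_smul]; norm_num
    conv_lhs => rw [h2]
    rw [add_mul, mul_add, smul_mul_assoc, smul_mul_assoc, mul_smul_comm, mul_smul_comm, h1,
      add_sub_add_left_eq_sub, ← smul_sub, smul_smul]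
    norm_num
  have h4 : (2 : ℂ) • (2 : ℂ) • (a * b - b * a) =
      (2 : ℂ) • ((a - parity a) * (b - parity b)) := by
    have e1 : (2 : ℂ) • (2 : ℂ) • (a * b - b * a)
        = - ((2 : ℂ) • (b * (a - parity a) - (a - parity a) * b)) := by
      rw [h, ← smul_neg, neg_sub]
    have e2 := mul_eq_of_odd (b - parity b) (parity_sub_parity a)
    rw [parity_sub_parity] at e2
    rw [e1, h, e2, two_smul]
    noncomm_ring
  have h5 : (2 : ℂ) • (a * b - b * a) = (a - parity a) * (b - parity b) :=
    smul_right_injective _ two_ne_zero h4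
  have h6 : (2 : ℂ) • parity (a * b - b * a) = (2 : ℂ) • (a * b - b * a) := by
    rw [← map_smul, h5, map_mul, parity_sub_parity, parity_sub_parity, neg_mul_neg]
  exact smul_right_injective _ two_ne_zero h6

end Superalgebra

section TwistedDerivation

variable {A : Type} [Ring A] [Algebra ℂ A] (α : A →ₐ[ℂ] GrassmannAlg) (ν : A →ₗ[ℂ] GrassmannAlg)

/-- A functional satisfying the Leibniz rule for the homomorphisms `α` and `twist ∘ α`. -/
def IsTwistedDerivation : Prop :=
  ∀ p q, ν (p * q) = α p * ν q + ν p * twist (α q)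

variable {α ν}

theorem IsTwistedDerivation.map_commutator (h : IsTwistedDerivation α ν) (p q : A) :
    ν (p * q - q * p) = (α p * ν q - ν q * parity (α p)) - (α q * ν p - ν p * parity (α q))
      - ν q * (twist (α p) - parity (α p)) + ν p * (twist (α q) - parity (α q)) := by
  rw [map_sub, h, h]
  noncomm_ring

theorem IsTwistedDerivation.map_lcs_two (h : IsTwistedDerivation α ν) {q : A}
    (hq : q ∈ lcs A 2) : parity (α q) = α q ∧ evenPart (ν q) ∈ genIdeal := by
  refine lcs_succ_induction (k := 0)
    (P := fun q => parity (α q) = α q ∧ evenPart (ν q) ∈ genIdeal) ?_ ?_ ?_ ?_ hq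
  · intro a b _
    refine ⟨by rw [map_sub, map_mul, map_mul, commutator_even], ?_⟩
    rw [h.map_commutator, map_add, map_sub, map_sub, evenPart_superCommutator,
      evenPart_superCommutator, sub_zero, zero_sub]
    exact add_mem (neg_mem (evenPart_mem_genIdeal (mul_mem_genIdeal _ (twist_sub_parity_mem _))))
      (evenPart_mem_genIdeal (mul_mem_genIdeal _ (twist_sub_parity_mem _)))
  · rintro a b ⟨h1, h2⟩ ⟨h3, h4⟩
    rw [map_add, map_add, map_add, map_add, h1, h3]
    exact ⟨rfl, add_mem h2 h4⟩
  · rintro c a ⟨h1, h2⟩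
    rw [map_smul, map_smul, map_smul, map_smul, h1]
    exact ⟨rfl, Submodule.smul_mem _ _ h2⟩
  · simp

theorem IsTwistedDerivation.map_lcs_three (h : IsTwistedDerivation α ν) {q : A}
    (hq : q ∈ lcs A 3) : α q = 0 ∧ ν q ∈ genIdeal := by
  refine lcs_succ_induction (k := 1) (P := fun q => α q = 0 ∧ ν q ∈ genIdeal) ?_ ?_ ?_ ?_ hq
  · intro a b hb
    obtain ⟨h1, h2⟩ := h.map_lcs_two hb
    refine ⟨by rw [map_sub, map_mul, map_mul, mul_eq_of_even _ h1, sub_self], ?_⟩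
    rw [h.map_commutator, h1, ← mul_eq_of_even (ν a) h1, sub_self, sub_zero]
    have h3 := twist_sub_parity_mem (α b)
    rw [h1] at h3
    exact add_mem (sub_mem (superCommutator_mem_genIdeal _ h2)
      (mul_mem_genIdeal _ (twist_sub_parity_mem _))) (mul_mem_genIdeal _ h3)
  · rintro a b ⟨h1, h2⟩ ⟨h3, h4⟩
    rw [map_add, map_add, h1, h3]
    exact ⟨add_zero _, add_mem h2 h4⟩
  · rintro c a ⟨h1, h2⟩
    rw [map_smul, map_smul, h1]
    exact ⟨smul_zero _, Submodule.smul_mem _ _ h2⟩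
  · simp

theorem IsTwistedDerivation.map_lcs_four (h : IsTwistedDerivation α ν) {q : A}
    (hq : q ∈ lcs A 4) : evenPart (ν q) = 0 := by
  refine lcs_succ_induction (k := 2) (P := fun q => evenPart (ν q) = 0) ?_ ?_ ?_ ?_ hq
  · intro a b hb
    obtain ⟨h1, h2⟩ := h.map_lcs_three hb
    rw [h.map_commutator, h1, genIdeal_mul_genIdeal h2 (twist_sub_parity_mem _)]
    simp [evenPart_superCommutator]
  · intro a b h1 h2
    rw [map_add, map_add, h1, h2, add_zero]
  · intro c a h1
    rw [map_smul, map_smul, h1, smul_zero]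
  · simp

end TwistedDerivation

section SquareZeroPerturbation

variable {R : Type*} [Ring R]

theorem mul_add_pow_eq_of_mul_eq_zero {y w p : R} (h : Commute p w) (hyp : y * p = 0) (k : ℕ) :
    y * (w + p) ^ k = y * w ^ k := by
  induction k with
  | zero => simp
  | succ k ih =>
    rw [pow_succ, ← mul_assoc, ih, mul_add, mul_assoc y _ p, ← (h.pow_right k).eq, ← mul_assoc y p,
      hyp, zero_mul, add_zero, pow_succ, mul_assoc]

theorem add_pow_succ_of_mul_self_eq_zero {w p : R} (h : Commute p w) (hp : p * p = 0) (k : ℕ) :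
    (w + p) ^ (k + 1) = w ^ (k + 1) + (k + 1) • (p * w ^ k) := by
  induction k with
  | zero => simp
  | succ k ih =>
    have h1 : p * (w + p) ^ (k + 1) = p * w ^ (k + 1) := mul_add_pow_eq_of_mul_eq_zero h hp _
    have h2 : w * (p * w ^ k) = p * w ^ (k + 1) := by
      rw [← mul_assoc, ← h.eq, mul_assoc, ← pow_succ']
    rw [pow_succ', add_mul, h1, ih, mul_add, mul_smul_comm, h2, ← pow_succ', succ_nsmul _ (k + 1),
      add_assoc]

end SquareZeroPerturbation

section SymplecticForm

theorem parity_oddGen_mul_oddGen (a b : ℕ) :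
    parity (oddGen a * oddGen b) = oddGen a * oddGen b := by
  simp

/-- Contraction with a coordinate form. -/
def contract (a : ℕ) : GrassmannAlg →ₗ[ℂ] GrassmannAlg :=
  CliffordAlgebra.contractLeft (Finsupp.lapply a)

theorem contract_oddGen_mul (a j : ℕ) (x : GrassmannAlg) :
    contract a (oddGen j * x) = (if j = a then x else 0) - oddGen j * contract a x := by
  have h := CliffordAlgebra.contractLeft_ι_mul (Q := (0 : QuadraticForm ℂ (ℕ →₀ ℂ)))
    (Finsupp.lapply a) (Finsupp.single j 1) x
  refine h.trans ?_
  congr 1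
  simp [Finsupp.single_apply]

theorem contract_contract_pair {a b : ℕ} (hab : a ≠ b) {x : GrassmannAlg} (ha : contract a x = 0)
    (hb : contract b x = 0) : contract b (contract a (oddGen a * oddGen b * x)) = x := by
  rw [mul_assoc, contract_oddGen_mul, contract_oddGen_mul, if_pos rfl, if_neg hab.symm, ha,
    mul_zero, sub_zero, mul_zero, sub_zero, contract_oddGen_mul, if_pos rfl, hb, mul_zero, sub_zero]

/-- The partial symplectic form supported on the pairs `(j, j + n)` with `j ∈ S`. -/
def sympl (n : ℕ) (S : Finset ℕ) : GrassmannAlg := ∑ j ∈ S, oddGen j * oddGen (j + n)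

theorem parity_sympl (n : ℕ) (S : Finset ℕ) : parity (sympl n S) = sympl n S := by
  rw [sympl, map_sum]
  exact Finset.sum_congr rfl fun _ _ => parity_oddGen_mul_oddGen _ _

theorem contract_sympl_pow {n a : ℕ} {S : Finset ℕ} (h : ∀ j ∈ S, j ≠ a ∧ j + n ≠ a) (k : ℕ) :
    contract a (sympl n S ^ k) = 0 := by
  induction k with
  | zero =>
    rw [pow_zero]
    exact CliffordAlgebra.contractLeft_one (Q := (0 : QuadraticForm ℂ (ℕ →₀ ℂ))) (Finsupp.lapply a)
  | succ k ih =>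
    rw [pow_succ', sympl, Finset.sum_mul, map_sum]
    refine Finset.sum_eq_zero fun j hj => ?_
    rw [mul_assoc, contract_oddGen_mul, contract_oddGen_mul, if_neg (h j hj).1,
      if_neg (h j hj).2, ← sympl, ih]
    simp

theorem sympl_pow_ne_zero {n : ℕ} (k : ℕ) {S : Finset ℕ} (hS : S ⊆ Finset.Icc 1 n)
    (hk : k ≤ S.card) : sympl n S ^ k ≠ 0 := by
  induction k generalizing S with
  | zero => simp
  | succ k ih =>
    obtain ⟨j, hj⟩ : S.Nonempty := Finset.card_pos.1 (by omega)
    have hS' : S.erase j ⊆ Finset.Icc 1 n := (Finset.erase_subset _ _).trans hS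
    have hcard : k ≤ (S.erase j).card := by
      rw [Finset.card_erase_of_mem hj]
      omega
    have hjn := Finset.mem_Icc.1 (hS hj)
    have hsplit : sympl n S = sympl n (S.erase j) + oddGen j * oddGen (j + n) :=
      (Finset.sum_erase_add _ _ hj).symm
    have hsq : oddGen j * oddGen (j + n) * (oddGen j * oddGen (j + n)) = 0 := by
      rw [mul_assoc, ← mul_assoc (oddGen (j + n)), oddGen_mul_oddGen (j + n) j, neg_mul, mul_assoc,
        oddGen_mul_self]
      simp
    have h1 : ∀ i ∈ S.erase j, i ≠ j ∧ i + n ≠ j := fun i hi => by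
      have := Finset.mem_Icc.1 (hS' hi)
      have := Finset.ne_of_mem_erase hi
      omega
    have h2 : ∀ i ∈ S.erase j, i ≠ j + n ∧ i + n ≠ j + n := fun i hi => by
      have := Finset.mem_Icc.1 (hS' hi)
      have := Finset.ne_of_mem_erase hi
      omega
    intro hzero
    rw [hsplit, add_pow_succ_of_mul_self_eq_zero
      (mul_eq_of_even _ (parity_sympl _ _)) hsq] at hzero
    have h3 := congrArg (fun x => contract (j + n) (contract j x)) hzero
    simp only [map_add, map_nsmul, map_zero, contract_sympl_pow h1, zero_add] at h3
    rw [contract_contract_pair (by omega) (contract_sympl_pow h1 k)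
      (contract_sympl_pow h2 k), ← Nat.cast_smul_eq_nsmul ℂ] at h3
    exact ih hS' hcard ((smul_eq_zero.1 h3).resolve_left (Nat.cast_ne_zero.2 (by omega)))

theorem oddGen_zero_mul_sympl_pow_ne_zero {n s : ℕ} (hs : s + 1 ≤ n) :
    oddGen 0 * oddGen (1 + n) * sympl n (Finset.Icc 1 n) ^ s ≠ 0 := by
  have h1 : 1 ∈ Finset.Icc 1 n := Finset.mem_Icc.2 (by omega)
  have hsplit : sympl n (Finset.Icc 1 n)
      = sympl n ((Finset.Icc 1 n).erase 1) + oddGen 1 * oddGen (1 + n) :=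
    (Finset.sum_erase_add _ _ h1).symm
  have hzero : oddGen 0 * oddGen (1 + n) * (oddGen 1 * oddGen (1 + n)) = 0 := by
    rw [mul_assoc, ← mul_assoc (oddGen (1 + n)), oddGen_mul_oddGen (1 + n) 1, neg_mul, mul_assoc,
      oddGen_mul_self]
    simp
  rw [hsplit, mul_add_pow_eq_of_mul_eq_zero (mul_eq_of_even _ (parity_sympl _ _)) hzero]
  have hS : (Finset.Icc 1 n).erase 1 ⊆ Finset.Icc 1 n := Finset.erase_subset _ _
  have hk : ∀ a, a = 0 ∨ a = 1 + n → ∀ i ∈ (Finset.Icc 1 n).erase 1, i ≠ a ∧ i + n ≠ a := by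
    intro a ha i hi
    have := Finset.mem_Icc.1 (hS hi)
    have := Finset.ne_of_mem_erase hi
    omega
  intro h
  have h2 := congrArg (fun x => contract (1 + n) (contract 0 x)) h
  simp only [map_zero] at h2
  rw [contract_contract_pair (by omega) (contract_sympl_pow (hk _ (Or.inl rfl)) s)
      (contract_sympl_pow (hk _ (Or.inr rfl)) s)] at h2
  refine sympl_pow_ne_zero s hS ?_ h2
  rw [Finset.card_erase_of_mem h1, Nat.card_Icc]
  omega

theorem twist_sympl {n : ℕ} (hn : 1 ≤ n) : twist (sympl n (Finset.Icc 1 n))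
    = sympl n (Finset.Icc 1 n) + oddGen 0 * oddGen (1 + n) := by
  have h : ∀ j ∈ Finset.Icc 1 n, twist (oddGen j * oddGen (j + n))
      = oddGen j * oddGen (j + n) + if j = 1 then oddGen 0 * oddGen (1 + n) else 0 := by
    intro j hj
    have := Finset.mem_Icc.1 hj
    rw [map_mul, twist_oddGen, twist_oddGen, if_neg (show j + n ≠ 1 by omega), sub_zero]
    split_ifs with h
    · subst h
      noncomm_ring
    · simp
  rw [sympl, map_sum, Finset.sum_congr rfl h, Finset.sum_add_distrib, Finset.sum_ite_eq',
    if_pos (Finset.mem_Icc.2 (by omega))]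

end SymplecticForm

section Evaluation

/-- The evaluation of the free algebra at shifted odd generators. -/
def oddEval (n : ℕ) : FA n →ₐ[ℂ] GrassmannAlg :=
  FreeAlgebra.lift ℂ fun i => oddGen (i + 1) + if (i : ℕ) + 1 = 1 then 1 else 0

/-- The triangular representation of the free algebra with diagonal entries `oddEval` and
`twist ∘ oddEval`. -/
def triangularRep (n : ℕ) : FA n →ₐ[ℂ] Matrix (Fin 2) (Fin 2) GrassmannAlg :=
  FreeAlgebra.lift ℂ fun i =>
    !![oddGen (i + 1) + if (i : ℕ) + 1 = 1 then 1 else 0, if (i : ℕ) + 1 = 1 + n then 1 else 0;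
      0, twist (oddGen (i + 1) + if (i : ℕ) + 1 = 1 then 1 else 0)]

/-- The upper right entry of the triangular representation. -/
def cornerEntry (n : ℕ) : FA n →ₗ[ℂ] GrassmannAlg :=
  Matrix.entryLinearMap ℂ GrassmannAlg 0 1 ∘ₗ (triangularRep n).toLinearMap

theorem triangularRep_eq (n : ℕ) (p : FA n) :
    triangularRep n p = !![oddEval n p, cornerEntry n p; 0, twist (oddEval n p)] := by
  suffices h : triangularRep n p 0 0 = oddEval n p ∧ triangularRep n p 1 0 = 0 ∧
      triangularRep n p 1 1 = twist (oddEval n p) by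
    ext i j
    fin_cases i <;> fin_cases j
    · exact h.1
    · rfl
    · exact h.2.1
    · exact h.2.2
  induction p using FreeAlgebra.induction with
  | grade0 r => simp [Algebra.algebraMap_eq_smul_one, Matrix.smul_apply]
  | grade1 i => simp [triangularRep, oddEval]
  | mul a b ha hb =>
    simp only [map_mul, Matrix.mul_apply, Fin.sum_univ_two, ha, hb]
    simp
  | add a b ha hb =>
    simp only [map_add, Matrix.add_apply, ha, hb]
    simp

theorem isTwistedDerivation_cornerEntry (n : ℕ) :
    IsTwistedDerivation (oddEval n) (cornerEntry n) := by
  intro p q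
  have h : cornerEntry n (p * q) = triangularRep n (p * q) 0 1 := rfl
  rw [h, map_mul, triangularRep_eq n p, triangularRep_eq n q]
  simp [Matrix.mul_apply]

theorem oddEval_X {n j : ℕ} (h1 : 1 ≤ j) (h2 : j ≤ 2 * n) :
    oddEval n (X n j) = oddGen j + if j = 1 then 1 else 0 := by
  rw [X, dif_pos ⟨h1, h2⟩, oddEval, FreeAlgebra.lift_ι_apply]
  simp only [Nat.sub_add_cancel h1]

theorem cornerEntry_X {n j : ℕ} (h1 : 1 ≤ j) (h2 : j ≤ 2 * n) :
    cornerEntry n (X n j) = if j = 1 + n then 1 else 0 := by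
  have h : cornerEntry n (X n j) = triangularRep n (X n j) 0 1 := rfl
  rw [h, X, dif_pos ⟨h1, h2⟩, triangularRep, FreeAlgebra.lift_ι_apply]
  simp [Nat.sub_add_cancel h1]

theorem twist_oddEval_X {n j : ℕ} (h1 : 1 ≤ j) (h2 : j ≤ 2 * n) :
    twist (oddEval n (X n j)) =
      (- oddGen j - if j = 1 then oddGen 0 else 0) + if j = 1 then 1 else 0 := by
  rw [oddEval_X h1 h2, map_add, twist_oddGen]
  split_ifs <;> simp

theorem oddEval_com_X {n i j : ℕ} (hi : 1 ≤ i) (hi' : i ≤ 2 * n) (hj : 1 ≤ j) (hj' : j ≤ 2 * n) :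
    oddEval n (com n (X n i) (X n j)) = (2 : ℂ) • (oddGen i * oddGen j) := by
  rw [com, map_sub, map_mul, map_mul, oddEval_X hi hi', oddEval_X hj hj', two_smul]
  have h := oddGen_mul_oddGen j i
  split_ifs <;> simp only [mul_add, add_mul, h, mul_one, one_mul, add_zero] <;> abel

theorem oddEval_omg (n : ℕ) : oddEval n (omg n) = sympl n (Finset.Icc 1 n) := by
  rw [omg, map_smul, map_sum, sympl, Finset.smul_sum]
  refine Finset.sum_congr rfl fun i hi => ?_
  have := Finset.mem_Icc.1 hi
  have h := oddEval_com_X (n := n) (i := i) (j := i + n) (by omega) (by omega) (by omega) (by omega)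
  rw [com] at h
  rw [h, smul_smul]
  norm_num

theorem oddEval_cvec {n r : ℕ} (hr : 1 ≤ r) (hr' : r ≤ 2 * n) :
    oddEval n (cvec n r) = (1 / 2 : ℂ) • (oddGen r * oddGen (1 + n))
      + if r = 1 then sympl n (Finset.Icc 1 n) else 0 := by
  have h : ∀ j ∈ Finset.Icc 1 n, oddEval n
      (X n j * com n (X n r) (X n (j + n)) - X n (j + n) * com n (X n r) (X n j))
      = (if j = 1 then (2 : ℂ) • (oddGen r * oddGen (1 + n)) else 0)
        - (4 : ℂ) • (oddGen r * (oddGen j * oddGen (j + n))) := by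
    intro j hj
    have := Finset.mem_Icc.1 hj
    rw [map_sub, map_mul, map_mul, oddEval_com_X hr hr' (by omega) (by omega),
      oddEval_com_X hr hr' (by omega) (by omega), oddEval_X (by omega) (by omega),
      oddEval_X (by omega) (by omega), if_neg (show j + n ≠ 1 by omega), add_zero, add_mul]
    have e1 : oddGen j * (oddGen r * oddGen (j + n))
        = - (oddGen r * (oddGen j * oddGen (j + n))) := by
      rw [← mul_assoc, oddGen_mul_oddGen j r, neg_mul, mul_assoc]
    have e2 : oddGen (j + n) * (oddGen r * oddGen j)
        = oddGen r * (oddGen j * oddGen (j + n)) := by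
      rw [mul_eq_of_even _ (parity_oddGen_mul_oddGen r j), mul_assoc]
    simp only [mul_smul_comm, e1, e2]
    split_ifs with h1
    · subst h1
      rw [one_mul]
      module
    · rw [zero_mul]
      module
  rw [cvec, map_add, map_smul, map_sum, Finset.sum_congr rfl h, Finset.sum_sub_distrib,
    Finset.sum_ite_eq', if_pos (Finset.mem_Icc.2 (by omega)), ← Finset.smul_sum, ← Finset.mul_sum,
    map_mul, oddEval_omg, oddEval_X hr hr', ← sympl, add_mul]
  split_ifs with h1
  · rw [one_mul]
    module
  · rw [zero_mul]
    module

theorem cornerEntry_com_X {n i : ℕ} (hi : 1 ≤ i) (hi' : i ≤ 2 * n) (q : FA n) :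
    evenPart (cornerEntry n (com n (X n i) q))
      = (if i = 1 then evenPart (cornerEntry n q * oddGen 0) else 0)
        + if i = 1 + n then evenPart (twist (oddEval n q) - oddEval n q) else 0 := by
  have h0 := evenPart_superCommutator (oddGen i) (cornerEntry n q)
  rw [parity_oddGen] at h0
  rw [com, map_sub, isTwistedDerivation_cornerEntry, isTwistedDerivation_cornerEntry,
    cornerEntry_X hi hi', twist_oddEval_X hi hi', oddEval_X hi hi']
  have h1 : ∀ (ν a t : GrassmannAlg) (x y : GrassmannAlg) (z : GrassmannAlg),
      z * t = t * z → ν * y = y * ν →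
      (oddGen i + y) * ν + t * a - (z * t + ν * (- oddGen i - x + y))
        = (oddGen i * ν - ν * - oddGen i) + ν * x + t * (a - z) := by
    intro ν a t x y z h h'
    simp only [add_mul, mul_add, mul_sub, mul_neg, h, h']
    abel
  rw [h1, map_add, map_add, h0, zero_add]
  · congr 1
    · split_ifs <;> simp
    · split_ifs <;> simp
  · split_ifs <;> simp
  · split_ifs <;> simp

theorem cornerEntry_com_X_X {n i j : ℕ} (hi : 1 ≤ i) (hi' : i ≤ 2 * n) (hj : 1 ≤ j)
    (hj' : j ≤ 2 * n) : cornerEntry n (com n (X n i) (X n j))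
      = (if j = 1 + n then oddGen i + oddGen i + (if i = 1 then oddGen 0 else 0) else 0)
        - if i = 1 + n then oddGen j + oddGen j + (if j = 1 then oddGen 0 else 0) else 0 := by
  rw [com, map_sub, isTwistedDerivation_cornerEntry, isTwistedDerivation_cornerEntry,
    cornerEntry_X hi hi', cornerEntry_X hj hj', twist_oddEval_X hi hi', twist_oddEval_X hj hj',
    oddEval_X hi hi', oddEval_X hj hj']
  split_ifs <;> simp only [mul_zero, zero_mul, mul_one, one_mul] <;> abel

theorem parity_cornerEntry_com_X_X {n i j : ℕ} (hi : 1 ≤ i) (hi' : i ≤ 2 * n) (hj : 1 ≤ j)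
    (hj' : j ≤ 2 * n) : parity (cornerEntry n (com n (X n i) (X n j)))
      = - cornerEntry n (com n (X n i) (X n j)) := by
  rw [cornerEntry_com_X_X hi hi' hj hj']
  split_ifs <;> simp only [map_add, map_sub, map_zero, parity_oddGen] <;> abel

theorem parity_twist (x : GrassmannAlg) : parity (twist x) = twist (parity x) := by
  have : parity.comp twist = twist.comp parity := by
    ext v
    simp [parity_ι, twist_ι, add_comm]
  exact DFunLike.congr_fun this x

theorem parity_cornerEntry_cvec {n : ℕ} (hn : 1 ≤ n) :
    parity (cornerEntry n (cvec n (1 + n))) = cornerEntry n (cvec n (1 + n)) := by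
  have hmul : ∀ x y : GrassmannAlg, parity x = -x → parity y = -y → parity (x * y) = x * y := by
    intro x y hx hy
    rw [map_mul, hx, hy, neg_mul_neg]
  have h1 : 1 ≤ 1 + n := by omega
  have h2 : 1 + n ≤ 2 * n := by omega
  have hω : parity (cornerEntry n (omg n)) = - cornerEntry n (omg n) := by
    rw [omg, map_smul, map_sum, map_smul, map_sum, ← smul_neg, ← Finset.sum_neg_distrib]
    congr 1
    refine Finset.sum_congr rfl fun i hi => ?_
    have := Finset.mem_Icc.1 hi
    exact parity_cornerEntry_com_X_X (by omega) (by omega) (by omega) (by omega)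
  have hD := isTwistedDerivation_cornerEntry n
  rw [cvec, map_add, map_add, map_smul, map_smul, map_sum, map_sum]
  congr 1
  · congr 1
    refine Finset.sum_congr rfl fun j hj => ?_
    have := Finset.mem_Icc.1 hj
    have e1 : cornerEntry n (X n j * com n (X n (1 + n)) (X n (j + n)))
        = oddGen j * cornerEntry n (com n (X n (1 + n)) (X n (j + n))) := by
      rw [hD, cornerEntry_X (by omega) (by omega), if_neg (by omega), zero_mul, add_zero,
        oddEval_X (by omega) (by omega)]
      split_ifs with h
      · subst h
        rw [com, sub_self, map_zero, mul_zero, mul_zero]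
      · rw [add_zero]
    have e2 : parity (cornerEntry n (X n (j + n) * com n (X n (1 + n)) (X n j)))
        = cornerEntry n (X n (j + n) * com n (X n (1 + n)) (X n j)) := by
      rw [hD, oddEval_X (by omega) (by omega), if_neg (show j + n ≠ 1 by omega), add_zero, map_add,
        hmul _ _ (parity_oddGen _)
          (parity_cornerEntry_com_X_X h1 h2 (by omega) (by omega)),
        oddEval_com_X h1 h2 (by omega) (by omega), map_mul, parity_twist, map_smul,
        parity_oddGen_mul_oddGen, cornerEntry_X (by omega) (by omega)]
      split_ifs <;> simp
    rw [map_sub, map_sub, e2, e1, hmul _ _ (parity_oddGen _)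
      (parity_cornerEntry_com_X_X h1 h2 (by omega) (by omega))]
  · rw [hD, oddEval_X h1 h2, if_neg (show 1 + n ≠ 1 by omega), add_zero, map_add,
      hmul _ _ (parity_oddGen _) hω, cornerEntry_X h1 h2, if_pos rfl, one_mul, parity_twist,
      oddEval_omg, parity_sympl]

theorem evenPart_cornerEntry_cvec {n : ℕ} (hn : 1 ≤ n) (s : ℕ) :
    evenPart (cornerEntry n (cvec n (1 + n) * omg n ^ s) * oddGen 0) = 0 := by
  rw [isTwistedDerivation_cornerEntry, oddEval_cvec (by omega) (by omega), oddGen_mul_self,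
    if_neg (by omega), smul_zero, add_zero, zero_mul, zero_add, map_pow, oddEval_omg,
    evenPart_apply, map_mul, map_mul, parity_cornerEntry_cvec hn, parity_twist,
    map_pow parity, parity_sympl, map_pow, parity_oddGen, mul_neg, add_neg_cancel]

theorem twist_sub_oddEval_cvec {n : ℕ} (hn : 1 ≤ n) (s : ℕ) :
    twist (oddEval n (cvec n 1 * omg n ^ s)) - oddEval n (cvec n 1 * omg n ^ s)
      = ((s : ℂ) + 3 / 2) • (oddGen 0 * oddGen (1 + n) * sympl n (Finset.Icc 1 n) ^ s) := by
  have hp : twist (oddGen 1 * oddGen (1 + n))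
      = oddGen 1 * oddGen (1 + n) + oddGen 0 * oddGen (1 + n) := by
    rw [map_mul, twist_oddGen, twist_oddGen, if_pos rfl, if_neg (by omega), sub_zero]
    noncomm_ring
  have hcomm : Commute (oddGen 0 * oddGen (1 + n)) (sympl n (Finset.Icc 1 n)) :=
    mul_eq_of_even _ (parity_sympl _ _)
  have hsq : ∀ a b, oddGen a * oddGen (1 + n) * (oddGen b * oddGen (1 + n)) = 0 := by
    intro a b
    rw [mul_assoc, ← mul_assoc (oddGen (1 + n)), oddGen_mul_oddGen (1 + n) b, neg_mul, mul_assoc,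
      oddGen_mul_self]
    simp
  rw [map_mul, map_pow, oddEval_omg, oddEval_cvec le_rfl (by omega), if_pos rfl, map_mul, map_pow,
    map_add, map_smul, hp, twist_sympl hn, add_mul _ _ (_ ^ s), ← pow_succ',
    add_pow_succ_of_mul_self_eq_zero hcomm (hsq 0 0), smul_mul_assoc, add_mul,
    mul_add_pow_eq_of_mul_eq_zero hcomm (hsq 0 0),
    mul_add_pow_eq_of_mul_eq_zero hcomm (hsq 1 0), add_mul _ _ (_ ^ s), ← pow_succ',
    smul_mul_assoc, ← Nat.cast_smul_eq_nsmul ℂ]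
  push_cast
  module

end Evaluation

/-- For `s ≥ 0` with `2s+1 ≤ n`, the element
`Z := ∑_{i=1}^{n} ([x_i, c_{i+n}·ω^s] − [x_{i+n}, c_i·ω^s])`
lies in `L₃(A_{2n})` but not in `L₄(A_{2n})`. -/
theorem stmt10 (n : ℕ) (hn : 1 ≤ n) (s : ℕ) (hs : 2*s + 1 ≤ n)
    (Z : FA n)
    (hZ : Z = ∑ i ∈ Finset.Icc 1 n,
      (com n (X n i) (cvec n (i+n) * (omg n)^s)
        - com n (X n (i+n)) (cvec n i * (omg n)^s))) :
    Z ∈ lcs (FA n) 3 ∧ Z ∉ lcs (FA n) 4 := by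
  subst hZ
  refine ⟨Submodule.sum_mem _ fun i _ => sub_mem ?_ ?_, fun hZ => ?_⟩
  · exact commutator_mul_pow_mem _ (cvec_mem_lcs_two n _) (omg_mem_lcs_two n) s
  · exact commutator_mul_pow_mem _ (cvec_mem_lcs_two n _) (omg_mem_lcs_two n) s
  · have h := (isTwistedDerivation_cornerEntry n).map_lcs_four hZ
    have hterm : ∀ i ∈ Finset.Icc 1 n, evenPart (cornerEntry n
        (com n (X n i) (cvec n (i + n) * omg n ^ s) - com n (X n (i + n)) (cvec n i * omg n ^ s)))
        = if i = 1 then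
            - evenPart (twist (oddEval n (cvec n 1 * omg n ^ s)) - oddEval n (cvec n 1 * omg n ^ s))
          else 0 := by
      intro i hi
      have := Finset.mem_Icc.1 hi
      rw [map_sub, map_sub, cornerEntry_com_X (by omega) (by omega),
        cornerEntry_com_X (by omega) (by omega), if_neg (show i ≠ 1 + n by omega),
        if_neg (show i + n ≠ 1 by omega), add_zero, zero_add]
      by_cases h1 : i = 1
      · subst h1
        rw [if_pos rfl, if_pos rfl, if_pos rfl, evenPart_cornerEntry_cvec hn, zero_sub]
      · rw [if_neg h1, if_neg (by omega), if_neg h1, sub_zero]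
    rw [map_sum, map_sum, Finset.sum_congr rfl hterm, Finset.sum_ite_eq',
      if_pos (Finset.mem_Icc.2 ⟨le_rfl, hn⟩), neg_eq_zero, twist_sub_oddEval_cvec hn, map_smul,
      evenPart_apply, map_mul, parity_oddGen_mul_oddGen, map_pow, parity_sympl, ← two_smul ℂ,
      smul_smul] at h
    refine oddGen_zero_mul_sympl_pow_ne_zero (show s + 1 ≤ n by omega)
      ((smul_eq_zero.1 h).resolve_left ?_)
    refine mul_ne_zero ?_ two_ne_zero
    have h3 : (s : ℂ) + 3 / 2 = ((2 * s + 3 : ℕ) : ℂ) / 2 := by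
      push_cast
      ring
    rw [h3]
    exact div_ne_zero (Nat.cast_ne_zero.2 (by omega)) two_ne_zero
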